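/- For every real number p > 0, one has 4π·(sinh((1/2)·arsinh(p/(2π))))² < p, where sinh is the real hyperbolic sine, arsinh is the inverse hyperbolic sine, and π is the circle constant. -/

import Mathlib

open Real

theorem two_mul_sinh_half_arsinh_sq_lt {x : ℝ} (hx : 0 < x) :
    2 * Real.sinh ((1 / 2) * Real.arsinh x) ^ 2 < x := by
  set y := (1 / 2) * Real.arsinh x with hy
  have hsinh : 0 < Real.sinh y :=
    Real.sinh_pos_iff.2 (mul_pos one_half_pos (Real.arsinh_pos_iff.2 hx))
  have hdouble : x = 2 * Real.sinh y * Real.cosh y := by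
    rw [← Real.sinh_two_mul, hy, ← mul_assoc, mul_one_div_cancel two_ne_zero, one_mul,
      Real.sinh_arsinh]
  calc 2 * Real.sinh y ^ 2 = 2 * Real.sinh y * Real.sinh y := by ring
    _ < 2 * Real.sinh y * Real.cosh y :=
      mul_lt_mul_of_pos_left (Real.sinh_lt_cosh y) (by positivity)
    _ = x := hdouble.symm

theorem stmt_2 (p : ℝ) (hp : 0 < p) :
    4 * π * (Real.sinh ((1 / 2) * Real.arsinh (p / (2 * π))))^2 < p := by
  have h := two_mul_sinh_half_arsinh_sq_lt (x := p / (2 * π)) (by positivity)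
  rw [lt_div_iff₀ (by positivity)] at h
  linarith
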